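/- Let V be a 4-dimensional real vector space and let x be an element of the second exterior power ⋀²V. Then x ∧ x = 0 in ⋀⁴V if and only if x is decomposable, i.e. x = u ∧ v for some u, v ∈ V. (This gives the description of the Grassmannian of two-planes G(2,V) as {x ∈ ⋀²V : x∧x = 0, |x| = 1}.) -/

import Mathlib

open ExteriorAlgebra

/-- The general 2-vector in four vectors, with coordinates `a, b, c, d, e, f`. -/
noncomputable def twoVec {V : Type*} [AddCommGroup V] [Module ℝ V] (p q r s : V)
    (a b c d e f : ℝ) : ExteriorAlgebra ℝ V :=
  a • (ι ℝ p * ι ℝ q) + b • (ι ℝ p * ι ℝ r) + c • (ι ℝ p * ι ℝ s)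
    + d • (ι ℝ q * ι ℝ r) + e • (ι ℝ q * ι ℝ s) + f • (ι ℝ r * ι ℝ s)

theorem iota_anti {V : Type*} [AddCommGroup V] [Module ℝ V] (u v : V) :
    ι ℝ u * ι ℝ v = -(ι ℝ v * ι ℝ u) :=
  eq_neg_of_add_eq_zero_left (ι_add_mul_swap u v)

theorem iota_anti_mul {V : Type*} [AddCommGroup V] [Module ℝ V] (u v : V)
    (y : ExteriorAlgebra ℝ V) :
    ι ℝ u * (ι ℝ v * y) = -(ι ℝ v * (ι ℝ u * y)) := by
  rw [← mul_assoc, iota_anti, neg_mul, mul_assoc]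

theorem iota_sq_mul {V : Type*} [AddCommGroup V] [Module ℝ V] (u : V)
    (y : ExteriorAlgebra ℝ V) : ι ℝ u * (ι ℝ u * y) = 0 := by
  rw [← mul_assoc, ι_sq_zero, zero_mul]

theorem twoVec_sq {V : Type*} [AddCommGroup V] [Module ℝ V] (p q r s : V)
    (a b c d e f : ℝ) :
    twoVec p q r s a b c d e f * twoVec p q r s a b c d e f =
      (2 * (a * f - b * e + c * d)) • (ι ℝ p * (ι ℝ q * (ι ℝ r * ι ℝ s))) := by
  unfold twoVec
  simp only [add_mul, mul_add, smul_mul_assoc, mul_smul_comm, mul_assoc, 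
    iota_anti q p, iota_anti r p, iota_anti s p, iota_anti r q, iota_anti s q, iota_anti s r,
    iota_anti_mul q p, iota_anti_mul r p, iota_anti_mul s p, iota_anti_mul r q,
    iota_anti_mul s q, iota_anti_mul s r, iota_sq_mul, ι_sq_zero, mul_neg, neg_neg, mul_zero,
    smul_zero, smul_neg, neg_zero]
  module

theorem twoVec_dec {V : Type*} [AddCommGroup V] [Module ℝ V] (p q r s : V)
    (a b c d e f : ℝ) (ha : a ≠ 0) (h : a * f - b * e + c * d = 0) :
    ∃ u v : V, twoVec p q r s a b c d e f = ι ℝ u * ι ℝ v := by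
  refine ⟨p - (d / a) • r - (e / a) • s, a • q + b • r + c • s, ?_⟩
  have hf : f = (b * e - c * d) / a := by field_simp; linarith
  subst hf
  unfold twoVec
  simp only [map_add, map_sub, map_smul, add_mul, sub_mul, mul_add, smul_mul_assoc, mul_smul_comm,
    iota_anti r q, iota_anti s q, iota_anti s r, ι_sq_zero, smul_zero, smul_neg]
  match_scalars <;> field_simp <;> ring

theorem twoVec_dec' {V : Type*} [AddCommGroup V] [Module ℝ V] (p q r s : V)
    (a b c d e f : ℝ) (h : a * f - b * e + c * d = 0) :
    ∃ u v : V, twoVec p q r s a b c d e f = ι ℝ u * ι ℝ v := by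
  by_cases ha : a = 0
  swap
  · exact twoVec_dec p q r s a b c d e f ha h
  by_cases hb : b = 0
  swap
  · obtain ⟨u, v, huv⟩ := twoVec_dec p r q s b a c (-d) f e hb (by linarith)
    refine ⟨u, v, huv ▸ ?_⟩
    simp only [twoVec, iota_anti r q]; module
  by_cases hc : c = 0
  swap
  · obtain ⟨u, v, huv⟩ := twoVec_dec p s r q c b a (-f) (-e) (-d) hc (by linarith)
    refine ⟨u, v, huv ▸ ?_⟩
    simp only [twoVec, iota_anti r q, iota_anti s q, iota_anti s r]; module
  subst ha hb hc
  by_cases hd : d = 0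
  swap
  · obtain ⟨u, v, huv⟩ := twoVec_dec q r s p d e 0 f 0 0 hd (by linarith)
    refine ⟨u, v, huv ▸ ?_⟩
    simp only [twoVec]; module
  subst hd
  refine ⟨e • q + f • r, s, ?_⟩
  simp only [twoVec, map_add, map_smul, add_mul, smul_mul_assoc]; module

theorem exists_twoVec {V : Type*} [AddCommGroup V] [Module ℝ V] (B : Module.Basis (Fin 4) ℝ V)
    (x : ExteriorAlgebra ℝ V) (hx : x ∈ ⋀[ℝ]^2 V) :
    ∃ a b c d e f : ℝ, x = twoVec (B 0) (B 1) (B 2) (B 3) a b c d e f := by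
  rw [← ιMulti_span_fixedDegree] at hx
  induction hx using Submodule.span_induction with
  | mem x h =>
    obtain ⟨w, rfl⟩ := h
    have h0 := B.sum_repr (w 0)
    have h1 := B.sum_repr (w 1)
    generalize B.repr (w 0) = g at h0
    generalize B.repr (w 1) = k at h1
    refine ⟨g 0 * k 1 - g 1 * k 0, g 0 * k 2 - g 2 * k 0, g 0 * k 3 - g 3 * k 0,
      g 1 * k 2 - g 2 * k 1, g 1 * k 3 - g 3 * k 1, g 2 * k 3 - g 3 * k 2, ?_⟩
    have : ιMulti ℝ 2 w = ι ℝ (w 0) * ι ℝ (w 1) := by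
      simp [ιMulti_apply, Matrix.vecTail]
    rw [this, ← h0, ← h1]
    simp only [Fin.sum_univ_four, twoVec, map_add, map_smul, add_mul, mul_add, smul_mul_assoc,
      mul_smul_comm, ι_sq_zero, smul_zero,
      iota_anti (B 1) (B 0), iota_anti (B 2) (B 0), iota_anti (B 3) (B 0),
      iota_anti (B 2) (B 1), iota_anti (B 3) (B 1), iota_anti (B 3) (B 2)]
    module
  | zero => exact ⟨0, 0, 0, 0, 0, 0, by simp [twoVec]⟩
  | add x y _ _ h1 h2 =>
    obtain ⟨a, b, c, d, e, f, rfl⟩ := h1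
    obtain ⟨a', b', c', d', e', f', rfl⟩ := h2
    exact ⟨a + a', b + b', c + c', d + d', e + e', f + f', by simp only [twoVec]; module⟩
  | smul t x _ h1 =>
    obtain ⟨a, b, c, d, e, f, rfl⟩ := h1
    exact ⟨t * a, t * b, t * c, t * d, t * e, t * f, by simp only [twoVec]; module⟩

theorem top_ne_zero' {V : Type*} [AddCommGroup V] [Module ℝ V] (B : Module.Basis (Fin 4) ℝ V) :
    ι ℝ (B 0) * (ι ℝ (B 1) * (ι ℝ (B 2) * ι ℝ (B 3))) ≠ 0 := by
  intro h
  have h1 : exteriorPower.ιMulti ℝ 4 B = 0 := by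
    apply Subtype.ext
    rw [exteriorPower.ιMulti_apply_coe]
    simpa [ιMulti_apply, Matrix.vecTail] using h
  have h2 := exteriorPower.alternatingMapLinearEquiv_apply_ιMulti B.det B
  rw [h1, map_zero, B.det_self] at h2
  exact zero_ne_one h2

/-- In a 4-dimensional real vector space `V`, an element `x` of the second exterior power
satisfies `x ∧ x = 0` if and only if `x` is decomposable, i.e. `x = u ∧ v` for some
`u, v ∈ V`. -/
theorem wedge_self_eq_zero_iff_decomposable
    {V : Type*} [AddCommGroup V] [Module ℝ V]
    (hdim : Module.finrank ℝ V = 4)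
    (x : ⋀[ℝ]^2 V) :
    (x : ExteriorAlgebra ℝ V) * (x : ExteriorAlgebra ℝ V) = 0 ↔
      ∃ u v : V, (x : ExteriorAlgebra ℝ V) = ι ℝ u * ι ℝ v := by
  constructor
  · intro h
    have : Module.Finite ℝ V := Module.finite_of_finrank_pos (by omega)
    let B := Module.finBasisOfFinrankEq ℝ V hdim
    obtain ⟨a, b, c, d, e, f, hx⟩ := exists_twoVec B x x.2
    rw [hx, twoVec_sq] at h
    have h' := (smul_eq_zero.mp h).resolve_right (top_ne_zero' B)
    rw [hx]
    exact twoVec_dec' _ _ _ _ a b c d e f (by linarith)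
  · rintro ⟨u, v, h⟩
    rw [h, mul_assoc, iota_anti_mul v u, mul_neg, iota_sq_mul, neg_zero]
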